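/- Gaussian truncation moment bounds: Let z ~ N(0,1) and γ > 0. There exist strictly positive constants K₁, K₂, K₃, K₄ such that for all n: E[ (E[z² 1{|z| ≤ n^{γ/2}}] − 1{|z| ≤ n^{γ/2}})⁴ ] ≤ K₁ exp(−K₂ n^γ) and E[ ((E[z² 1{|z| ≤ n^{γ/2}}])^{1/2} − 1{|z| ≤ n^{γ/2}})⁸ ] ≤ K₃ exp(−K₄ n^γ). -/

import Mathlib

/- STATEMENT 16: Gaussian truncation moment bounds (Lemma A.9 of the paper):
for z ~ N(0,1) and γ > 0 there are K₁, K₂, K₃, K₄ > 0 such that for all n ≥ 1,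
 E[(E[z²1{|z|≤n^{γ/2}}] − 1{|z|≤n^{γ/2}})⁴] ≤ K₁ e^{−K₂ n^γ} and
 E[((E[z²1{|z|≤n^{γ/2}}])^{1/2} − 1{|z|≤n^{γ/2}})⁸] ≤ K₃ e^{−K₄ n^γ}. -/

open MeasureTheory Filter Topology Real Set ProbabilityTheory
open scoped ENNReal Classical

noncomputable section

abbrev stdGauss : Measure ℝ := gaussianReal 0 1

/-- `E[z² 1{|z| ≤ c}]` for `z ~ N(0,1)`. -/
def truncNorm (c : ℝ) : ℝ := ∫ x in {x : ℝ | |x| ≤ c}, x ^ 2 ∂stdGauss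

theorem integrable_sq_stdGauss : Integrable (fun x : ℝ => x ^ 2) stdGauss :=
  (memLp_id_gaussianReal 2).integrable_sq

theorem integral_sq_stdGauss : ∫ x, x ^ 2 ∂stdGauss = 1 := by
  have h := variance_eq_sub (memLp_id_gaussianReal (μ := 0) (v := 1) 2)
  rw [variance_id_gaussianReal] at h
  simpa using h.symm

theorem truncNorm_add_tail (c : ℝ) :
    truncNorm c + ∫ x in {x : ℝ | |x| ≤ c}ᶜ, x ^ 2 ∂stdGauss = 1 := by
  rw [truncNorm, integral_add_compl (measurableSet_le (by fun_prop) (by fun_prop))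
    integrable_sq_stdGauss, integral_sq_stdGauss]

theorem truncNorm_nonneg (c : ℝ) : 0 ≤ truncNorm c :=
  integral_nonneg fun x => sq_nonneg x

theorem one_add_sq_le_exp {C c z : ℝ} (hC : 0 < C) (hc : 0 ≤ c) (hz : c < |z|) :
    1 + z ^ 2 ≤ (1 + 2 / C) * rexp (-(C / 2) * c ^ 2) * rexp (C * z ^ 2) := by
  have hcz : c ^ 2 ≤ z ^ 2 := by
    rw [← sq_abs z]
    gcongr
  have hexp : 1 ≤ rexp (C / 2 * z ^ 2) := Real.one_le_exp (by positivity)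
  have hsq : z ^ 2 ≤ 2 / C * rexp (C / 2 * z ^ 2) := by
    have h := Real.add_one_le_exp (C / 2 * z ^ 2)
    calc z ^ 2 = 2 / C * (C / 2 * z ^ 2) := by field_simp
      _ ≤ 2 / C * rexp (C / 2 * z ^ 2) := by gcongr; linarith
  calc 1 + z ^ 2 ≤ (1 + 2 / C) * rexp (C / 2 * z ^ 2) := by linarith
    _ ≤ (1 + 2 / C) * rexp (-(C / 2) * c ^ 2 + C * z ^ 2) := by
      gcongr
      nlinarith
    _ = _ := by rw [Real.exp_add, mul_assoc]

theorem one_sub_truncNorm_le {C c : ℝ} (hC : 0 < C) (hc : 0 ≤ c)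
    (hint : Integrable (fun x : ℝ => rexp (C * x ^ 2)) stdGauss) :
    1 - truncNorm c ≤
      (1 + 2 / C) * rexp (-(C / 2) * c ^ 2) * ∫ x, rexp (C * x ^ 2) ∂stdGauss := by
  have hms : MeasurableSet {x : ℝ | |x| ≤ c} := measurableSet_le (by fun_prop) (by fun_prop)
  calc 1 - truncNorm c = ∫ x in {x : ℝ | |x| ≤ c}ᶜ, x ^ 2 ∂stdGauss := by
        linarith [truncNorm_add_tail c]
    _ ≤ ∫ x in {x : ℝ | |x| ≤ c}ᶜ,
          (1 + 2 / C) * rexp (-(C / 2) * c ^ 2) * rexp (C * x ^ 2) ∂stdGauss := by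
        refine setIntegral_mono_on integrable_sq_stdGauss.integrableOn
          (hint.const_mul _).integrableOn hms.compl fun x hx => ?_
        have := one_add_sq_le_exp hC hc (not_le.mp hx)
        linarith
    _ ≤ ∫ x, (1 + 2 / C) * rexp (-(C / 2) * c ^ 2) * rexp (C * x ^ 2) ∂stdGauss :=
        setIntegral_le_integral (hint.const_mul _) (ae_of_all _ fun x => by
          simp only [Pi.zero_apply]
          positivity)
    _ = _ := integral_const_mul _ _

theorem integral_sub_indicator_pow_le {C c s : ℝ} {k : ℕ} (hC : 0 < C) (hc : 0 ≤ c)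
    (hint : Integrable (fun x : ℝ => rexp (C * x ^ 2)) stdGauss) (hk : Even k) (hk0 : k ≠ 0)
    (hs0 : 0 ≤ s) (hs1 : s ≤ 1) (hs : truncNorm c ≤ s) :
    ∫ z, (s - (if |z| ≤ c then (1 : ℝ) else 0)) ^ k ∂stdGauss ≤
      2 * (1 + 2 / C) * (∫ x, rexp (C * x ^ 2) ∂stdGauss) * rexp (-(C / 2) * c ^ 2) := by
  calc ∫ z, (s - (if |z| ≤ c then (1 : ℝ) else 0)) ^ k ∂stdGauss
      ≤ ∫ z, ((1 - truncNorm c) +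
          (1 + 2 / C) * rexp (-(C / 2) * c ^ 2) * rexp (C * z ^ 2)) ∂stdGauss := by
        refine integral_mono_of_nonneg (ae_of_all _ fun z => hk.pow_nonneg _)
          ((integrable_const _).add (hint.const_mul _)) (ae_of_all _ fun z => ?_)
        have hnonneg : 0 ≤ (1 + 2 / C) * rexp (-(C / 2) * c ^ 2) * rexp (C * z ^ 2) := by
          positivity
        by_cases hz : |z| ≤ c
        · simp only [hz, if_true]
          rw [← hk.neg_pow, neg_sub]
          have := pow_le_of_le_one (sub_nonneg.mpr hs1) (by linarith : 1 - s ≤ 1) hk0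
          linarith
        · simp only [hz, if_false, sub_zero]
          have := pow_le_one₀ (n := k) hs0 hs1
          have := one_add_sq_le_exp hC hc (not_le.mp hz)
          nlinarith [sq_nonneg z]
    _ = (1 - truncNorm c) +
          (1 + 2 / C) * rexp (-(C / 2) * c ^ 2) * ∫ x, rexp (C * x ^ 2) ∂stdGauss := by
        rw [integral_add (integrable_const _) (hint.const_mul _), integral_const_mul]
        simp
    _ ≤ _ := by linarith [one_sub_truncNorm_le hC hc hint]

theorem gaussian_truncation_moment_bounds (γ : ℝ) (hγ : 0 < γ) :
    ∃ K₁ > (0 : ℝ), ∃ K₂ > (0 : ℝ), ∃ K₃ > (0 : ℝ), ∃ K₄ > (0 : ℝ),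
      ∀ n : ℕ, 1 ≤ n →
        (∫ z, (truncNorm ((n : ℝ) ^ (γ / 2)) -
            (if |z| ≤ (n : ℝ) ^ (γ / 2) then (1 : ℝ) else 0)) ^ 4 ∂stdGauss)
          ≤ K₁ * Real.exp (-K₂ * (n : ℝ) ^ γ) ∧
        (∫ z, (Real.sqrt (truncNorm ((n : ℝ) ^ (γ / 2))) -
            (if |z| ≤ (n : ℝ) ^ (γ / 2) then (1 : ℝ) else 0)) ^ 8 ∂stdGauss)
          ≤ K₃ * Real.exp (-K₄ * (n : ℝ) ^ γ) := by
  obtain ⟨C, hC, hint⟩ := IsGaussian.exists_integrable_exp_sq stdGauss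
  simp only [Real.norm_eq_abs, sq_abs] at hint
  have hM : 0 < ∫ x, rexp (C * x ^ 2) ∂stdGauss := integral_exp_pos hint
  have hK : 0 < 2 * (1 + 2 / C) * ∫ x, rexp (C * x ^ 2) ∂stdGauss := by positivity
  refine ⟨_, hK, C / 2, by positivity, _, hK, C / 2, by positivity, fun n _ => ?_⟩
  have hc : 0 ≤ (n : ℝ) ^ (γ / 2) := by positivity
  have hsq : (n : ℝ) ^ γ = ((n : ℝ) ^ (γ / 2)) ^ 2 := by
    rw [← Real.rpow_mul_natCast (Nat.cast_nonneg n)]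
    norm_num
  rw [hsq]
  have h0 := truncNorm_nonneg ((n : ℝ) ^ (γ / 2))
  have h1 : truncNorm ((n : ℝ) ^ (γ / 2)) ≤ 1 := by
    have : 0 ≤ ∫ x in {x : ℝ | |x| ≤ (n : ℝ) ^ (γ / 2)}ᶜ, x ^ 2 ∂stdGauss :=
      integral_nonneg fun x => sq_nonneg x
    linarith [truncNorm_add_tail ((n : ℝ) ^ (γ / 2))]
  exact ⟨integral_sub_indicator_pow_le hC hc hint (by decide) (by norm_num) h0 h1 le_rfl,
    integral_sub_indicator_pow_le hC hc hint (by decide) (by norm_num) (Real.sqrt_nonneg _)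
      (Real.sqrt_le_one.mpr h1) (Real.le_sqrt_self_iff.mpr h1)⟩
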